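/- Sign determination in the non-cyclic index 4 case: assume the Gauss sum satisfies G(χ) = 2^{−y} p^x (a + b√−L)(a′ + b′√−L′) with integers a, b, a′, b′, x ≥ 0, y ≥ 0 and √−L, √−L′ ∈ K. Then the following four congruences hold modulo 𝔓: (i) if S(−n) = (p−1)x then t(−n)·(a + b√−L)(a′ + b′√−L′) ≡ (−1)^{x+1}·2^y, and if S(−n) > (p−1)x then (a + b√−L)(a′ + b′√−L′) ≡ 0; (ii) if S(−sn) = (p−1)x then t(−sn)·(a − b√−L)(a′ + b′√−L′) ≡ (−1)^{x+1}·2^y, and if S(−sn) > (p−1)x then (a − b√−L)(a′ + b′√−L′) ≡ 0; (iii) if S(−tn) = (p−1)x then t(−tn)·(a + b√−L)(a′ − b′√−L′) ≡ (−1)^{x+1}·2^y, and if S(−tn) > (p−1)x then (a + b√−L)(a′ − b′√−L′) ≡ 0; (iv) if S(−stn) = (p−1)x then t(−stn)·(a − b√−L)(a′ − b′√−L′) ≡ (−1)^{x+1}·2^y, and if S(−stn) > (p−1)x then (a − b√−L)(a′ − b′√−L′) ≡ 0. -/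

import Mathlib

open NumberField

/-- The digit sum `S(a) = c₀ + ⋯ + c_{f−1}` of the base-`p` expansion of `a`. -/
def digitSum (p a : ℕ) : ℕ := (Nat.digits p a).sum

/-- The product `t(a) = c₀!·c₁!·⋯·c_{f−1}!` of the factorials of the base-`p`
digits of `a`. -/
def digitFacProd (p a : ℕ) : ℕ := ((Nat.digits p a).map Nat.factorial).prod

section Digits

variable {p : ℕ}

theorem digitSum_base_mul (hp : 1 < p) (k : ℕ) : digitSum p (p * k) = digitSum p k := by
  rcases k.eq_zero_or_pos with rfl | hk
  · simp
  · simp [digitSum, Nat.digits_base_mul hp hk]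

theorem digitFacProd_base_mul (hp : 1 < p) (k : ℕ) :
    digitFacProd p (p * k) = digitFacProd p k := by
  rcases k.eq_zero_or_pos with rfl | hk
  · simp
  · simp [digitFacProd, Nat.digits_base_mul hp hk]

theorem succ_div_mod_of_not_dvd {k : ℕ} (hk : ¬ p ∣ k + 1) :
    (k + 1) / p = k / p ∧ (k + 1) % p = k % p + 1 := by
  have h1 : (k + 1) / p = k / p := by simp [Nat.succ_div, hk]
  refine ⟨h1, ?_⟩
  have h2 := Nat.div_add_mod (k + 1) p
  have h3 := Nat.div_add_mod k p
  rw [h1] at h2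
  omega

theorem digitSum_eq_mod_add (hp : 1 < p) (k : ℕ) :
    digitSum p k = k % p + digitSum p (k / p) := by
  rcases k.eq_zero_or_pos with rfl | hk
  · simp [digitSum]
  · simp [digitSum, Nat.digits_def' hp hk]

theorem digitFacProd_eq_factorial_mul (hp : 1 < p) (k : ℕ) :
    digitFacProd p k = (k % p).factorial * digitFacProd p (k / p) := by
  rcases k.eq_zero_or_pos with rfl | hk
  · simp [digitFacProd]
  · simp [digitFacProd, Nat.digits_def' hp hk]

theorem digitSum_succ_of_not_dvd (hp : 1 < p) {k : ℕ} (hk : ¬ p ∣ k + 1) :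
    digitSum p (k + 1) = digitSum p k + 1 := by
  obtain ⟨h1, h2⟩ := succ_div_mod_of_not_dvd hk
  rw [digitSum_eq_mod_add hp, digitSum_eq_mod_add hp k, h1, h2]
  ring

theorem digitFacProd_succ_of_not_dvd (hp : 1 < p) {k : ℕ} (hk : ¬ p ∣ k + 1) :
    digitFacProd p (k + 1) = (k + 1) % p * digitFacProd p k := by
  obtain ⟨h1, h2⟩ := succ_div_mod_of_not_dvd hk
  rw [digitFacProd_eq_factorial_mul hp, digitFacProd_eq_factorial_mul hp k, h1, h2,
    Nat.factorial_succ]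
  ring

theorem digitSum_one (hp : 1 < p) : digitSum p 1 = 1 := by
  simp [digitSum, Nat.digits_of_lt p 1 one_ne_zero hp]

theorem digitFacProd_one (hp : 1 < p) : digitFacProd p 1 = 1 := by
  simp [digitFacProd, Nat.digits_of_lt p 1 one_ne_zero hp]

end Digits

section FieldSums

variable {F : Type*} [Field F] [Fintype F]

theorem sum_inv_mul_self : ∑ u : F, u⁻¹ * u = -1 := by
  classical
  have h : ∀ u : F, u⁻¹ * u = 1 - if u = 0 then 1 else 0 := by
    intro u
    by_cases hu : u = 0 <;> simp [hu]
  simp [Finset.sum_congr rfl fun u _ => h u]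

theorem sum_inv_mul_one_sub_pow (hq : 2 < Fintype.card F) {m : ℕ}
    (hm : m ≤ Fintype.card F - 1) : ∑ u : F, u⁻¹ * (1 - u) ^ m = m := by
  classical
  induction m with
  | zero =>
    simp only [pow_zero, mul_one, Nat.cast_zero]
    rw [← FiniteField.sum_pow_lt_card_sub_one F 1 (by omega)]
    exact Fintype.sum_bijective _ inv_involutive.bijective _ _ fun u => (pow_one _).symm
  | succ m ih =>
    have h : ∀ u : F, u⁻¹ * (1 - u) ^ (m + 1) =
        u⁻¹ * (1 - u) ^ m - ((1 - u) ^ m - if u = 0 then 1 else 0) := by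
      intro u
      by_cases hu : u = 0
      · simp [hu]
      · simp only [hu, if_false]
        field_simp
        ring
    have h2 : ∑ u : F, (1 - u) ^ m = 0 := by
      rw [← FiniteField.sum_pow_lt_card_sub_one F m (by omega)]
      exact Equiv.sum_comp (Equiv.subLeft (1 : F)) (fun u => u ^ m)
    rw [Finset.sum_congr rfl fun u _ => h u, Finset.sum_sub_distrib, Finset.sum_sub_distrib,
      ih (by omega), h2]
    simp

theorem sum_inv_mul_trace {p : ℕ} [Fact p.Prime] [Algebra (ZMod p) F] :
    ∑ u : F, u⁻¹ * algebraMap (ZMod p) F (Algebra.trace (ZMod p) F u) = -1 := by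
  have hp : p.Prime := Fact.out
  have hcard : Fintype.card F = p ^ Module.finrank (ZMod p) F := by
    rw [Module.card_eq_pow_finrank (K := ZMod p), ZMod.card]
  have hd : 0 < Module.finrank (ZMod p) F := Module.finrank_pos
  simp_rw [FiniteField.algebraMap_trace_eq_sum_pow, Finset.mul_sum, Nat.card_zmod]
  rw [Finset.sum_comm, Finset.sum_eq_single 0]
  · simpa using sum_inv_mul_self (F := F)
  · intro i hi hi0
    have h1 : 1 < p ^ i := Nat.one_lt_pow hi0 hp.one_lt
    have h2 : p ^ i < Fintype.card F := by
      rw [hcard]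
      exact Nat.pow_lt_pow_right hp.one_lt (Finset.mem_range.1 hi)
    rw [← FiniteField.sum_pow_lt_card_sub_one F (p ^ i - 1) (by omega)]
    refine Finset.sum_congr rfl fun u _ => ?_
    obtain ⟨m, hm⟩ : ∃ m, p ^ i = m + 2 := ⟨p ^ i - 2, by omega⟩
    rw [hm]
    by_cases hu : u = 0
    · simp [hu]
    · rw [pow_succ' u (m + 1), inv_mul_cancel_left₀ hu]
      rfl
  · intro h
    simp [hd.ne'] at h

end FieldSums

section Stickelberger

variable {F R : Type*} [Field F] [Fintype F] [CommRing R] {p : ℕ} [Fact p.Prime]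
  [Algebra (ZMod p) F]

/-- The additive character `z ↦ ζ ^ Tr z` of a finite field attached to a `p`-th root of unity. -/
noncomputable def traceAddChar (F : Type*) [Field F] [Algebra (ZMod p) F] {ζ : R}
    (hζ : ζ ^ p = 1) : AddChar F R :=
  haveI : NeZero p := ⟨(Fact.out : p.Prime).ne_zero⟩
  (AddChar.zmodChar p hζ).compAddMonoidHom (Algebra.trace (ZMod p) F).toAddMonoidHom

omit [Fintype F] in
theorem traceAddChar_apply {ζ : R} (hζ : ζ ^ p = 1) (z : F) :
    traceAddChar F hζ z = ζ ^ (Algebra.trace (ZMod p) F z).val := rfl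

theorem traceAddChar_pow_char {ζ : R} (hζ : ζ ^ p = 1) (z : F) :
    traceAddChar F hζ (z ^ p) = traceAddChar F hζ z := by
  have h := Algebra.trace_eq_of_algEquiv
    (FiniteField.frobeniusAlgEquivOfAlgebraic (ZMod p) F) z
  simp only [FiniteField.coe_frobeniusAlgEquivOfAlgebraic, ZMod.card] at h
  rw [traceAddChar_apply, traceAddChar_apply, h]

theorem gaussSum_pow_char {ζ : R} (hζ : ζ ^ p = 1) (χ : MulChar F R) :
    gaussSum (χ ^ p) (traceAddChar F hζ) = gaussSum χ (traceAddChar F hζ) := by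
  have hp : p.Prime := Fact.out
  have h := Equiv.sum_comp
    (FiniteField.frobeniusAlgEquivOfAlgebraic (ZMod p) F).toEquiv
    (fun z => χ z * traceAddChar F hζ z)
  rw [gaussSum, gaussSum, ← h]
  refine Finset.sum_congr rfl fun z _ => ?_
  have hz : (FiniteField.frobeniusAlgEquivOfAlgebraic (ZMod p) F).toEquiv z = z ^ p := by
    simp
  rw [hz, traceAddChar_pow_char, χ.pow_apply' hp.ne_zero, map_pow]

theorem exists_one_add_pow_eq (x : R) (m : ℕ) :
    ∃ r, (1 + x) ^ m = 1 + m * x + x ^ 2 * r := by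
  induction m with
  | zero => exact ⟨0, by simp⟩
  | succ m ih =>
    obtain ⟨r, hr⟩ := ih
    exact ⟨m + r + x * r, by rw [pow_succ, hr]; push_cast; ring⟩

variable (red : R →+* F)

include red in
theorem map_sub_one_eq_zero_of_pow_char {ζ : R} (hζ : ζ ^ p = 1) : red (ζ - 1) = 0 := by
  have : CharP F p := charP_of_injective_algebraMap' (ZMod p) p
  have h : (red ζ - 1) ^ p = 0 := by
    rw [sub_pow_char, ← map_pow, hζ]
    simp
  simpa using pow_eq_zero_iff (Nat.Prime.ne_zero Fact.out) |>.1 h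

theorem exists_eq_pow_sub_one_mul [IsDomain R] {ζ : R} (hζ : IsPrimitiveRoot ζ p)
    (hodd : Odd p) :
    ∃ u : R, (p : R) = (ζ - 1) ^ (p - 1) * u ∧ red u = -1 := by
  have : CharP F p := charP_of_injective_algebraMap' (ZMod p) p
  have hp : p.Prime := Fact.out
  have hz : red ζ = 1 := by
    simpa [sub_eq_zero] using map_sub_one_eq_zero_of_pow_char red hζ.pow_eq_one
  refine ⟨∏ k ∈ Finset.range (p - 1), ∑ i ∈ Finset.range (k + 1), ζ ^ i, ?_, ?_⟩
  · have hp1 : p - 1 + 1 = p := Nat.sub_add_cancel hp.one_le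
    have h := IsPrimitiveRoot.prod_one_sub_pow_eq_order (n := p - 1) (μ := ζ) (by rwa [hp1])
    have hcast : ((p - 1 : ℕ) : R) + 1 = p := by exact_mod_cast congrArg (Nat.cast (R := R)) hp1
    rw [hcast] at h
    rw [← h]
    have h2 : ∀ k, 1 - ζ ^ (k + 1) = -((ζ - 1) * ∑ i ∈ Finset.range (k + 1), ζ ^ i) := by
      intro k
      rw [mul_geom_sum]
      ring
    rw [Finset.prod_congr rfl fun k _ => h2 k, Finset.prod_neg, Finset.prod_mul_distrib]
    have heven : Even (p - 1) := by
      obtain ⟨r, hr⟩ := hodd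
      exact ⟨r, by omega⟩
    simp [heven.neg_one_pow]
  · simp only [map_prod, map_sum, map_pow, hz, one_pow, Finset.sum_const, Finset.card_range,
      nsmul_eq_mul, mul_one]
    rw [← Nat.cast_prod, Finset.prod_range_add_one_eq_factorial]
    have := congrArg (algebraMap (ZMod p) F) (ZMod.wilsons_lemma p)
    rwa [map_natCast, map_neg, map_one] at this

variable [IsDomain R] {χ : MulChar F R} (hχ : ∀ u, red (χ u) = u⁻¹)

omit [IsDomain R] in
include hχ in
theorem pow_ne_one_of_map_eq_inv {k : ℕ} (hk : 0 < k) (hk' : k < Fintype.card F - 1) :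
    χ ^ k ≠ 1 := by
  intro h
  have h1 : Fintype.card F - 1 ∣ k := by
    rw [← FiniteField.forall_pow_eq_one_iff F]
    intro x
    have h2 : (χ ^ k) x = 1 := by rw [h, MulChar.one_apply_coe]
    have h3 := congrArg red h2
    rw [MulChar.pow_apply_coe, map_pow, hχ, map_one, inv_pow, inv_eq_one] at h3
    exact Units.ext (by simpa using h3)
  exact absurd (Nat.le_of_dvd hk h1) (by omega)

omit [IsDomain R] in
include hχ in
theorem map_jacobiSum_pow {k : ℕ} (hk : 0 < k) (hk' : k + 1 < Fintype.card F - 1) :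
    red (jacobiSum χ (χ ^ k)) = -((k : F) + 1) := by
  have h := sum_inv_mul_one_sub_pow (F := F) (m := Fintype.card F - 1 - k) (by omega) (by omega)
  have hcast : ((Fintype.card F - 1 - k : ℕ) : F) = -((k : F) + 1) := by
    rw [Nat.cast_sub (by omega), Nat.cast_sub (by omega), FiniteField.cast_card_eq_zero]
    push_cast
    ring
  rw [hcast] at h
  rw [← h, jacobiSum, map_sum]
  refine Finset.sum_congr rfl fun u _ => ?_
  rw [map_mul, χ.pow_apply' hk.ne', map_pow, hχ, hχ]
  congr 1
  by_cases hu : 1 - u = 0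
  · rw [hu, inv_zero, zero_pow hk.ne', zero_pow (by omega)]
  · rw [inv_pow]
    refine inv_eq_of_mul_eq_one_right ?_
    rw [← pow_add, show k + (Fintype.card F - 1 - k) = Fintype.card F - 1 by omega]
    exact FiniteField.pow_card_sub_one_eq_one _ hu

include hχ in
theorem exists_gaussSum_eq_mul (hq : 2 < Fintype.card F) {ζ : R} (hζ : ζ ^ p = 1) :
    ∃ h, gaussSum χ (traceAddChar F hζ) = (ζ - 1) * h ∧ red h = -1 := by
  have : CharP F p := charP_of_injective_algebraMap' (ZMod p) p
  have hχ1 : χ ≠ 1 := by simpa using pow_ne_one_of_map_eq_inv red hχ one_pos (by omega)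
  choose r hr using exists_one_add_pow_eq (ζ - 1)
  refine ⟨∑ z : F, χ z * ((Algebra.trace (ZMod p) F z).val +
    (ζ - 1) * r (Algebra.trace (ZMod p) F z).val), ?_, ?_⟩
  · have h0 := MulChar.sum_eq_zero_of_ne_one hχ1
    rw [gaussSum, Finset.mul_sum, ← sub_eq_zero, ← Finset.sum_sub_distrib, ← h0]
    refine Finset.sum_congr rfl fun z _ => ?_
    have h := hr (Algebra.trace (ZMod p) F z).val
    rw [add_sub_cancel] at h
    rw [traceAddChar_apply, h]
    ring
  · rw [← sum_inv_mul_trace (F := F) (p := p), map_sum]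
    refine Finset.sum_congr rfl fun z _ => ?_
    rw [map_mul, map_add, map_mul, map_sub_one_eq_zero_of_pow_char red hζ, hχ, map_natCast]
    have : algebraMap (ZMod p) F (Algebra.trace (ZMod p) F z) =
        ((Algebra.trace (ZMod p) F z).val : F) := by
      rw [← map_natCast (algebraMap (ZMod p) F), ZMod.natCast_zmod_val]
    rw [this]
    ring

include hχ in
/-- Stickelberger's congruence, localized at the kernel of `red`: up to a factor `w` prime to this
kernel, `G(χ ^ k)` is `(ζ - 1) ^ S(k) * h` with `t(k) * h ≡ -w`. -/
theorem exists_mul_gaussSum_pow_eq (hq : 2 < Fintype.card F) {ζ : R} (hζ : ζ ^ p = 1) {k : ℕ}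
    (hk : 0 < k) (hk' : k < Fintype.card F - 1) :
    ∃ w h : R, red w ≠ 0 ∧
      w * gaussSum (χ ^ k) (traceAddChar F hζ) = (ζ - 1) ^ digitSum p k * h ∧
      (digitFacProd p k : F) * red h = -red w := by
  have : CharP F p := charP_of_injective_algebraMap' (ZMod p) p
  have hp : p.Prime := Fact.out
  obtain ⟨h₁, hg₁, hh₁⟩ := exists_gaussSum_eq_mul red hχ hq hζ
  induction k using Nat.strong_induction_on with
  | _ k ih =>
  by_cases hdvd : p ∣ k
  · obtain ⟨m, rfl⟩ := hdvd
    have hm : 0 < m := Nat.pos_of_mul_pos_left hk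
    have hlt : m < p * m := (Nat.lt_mul_iff_one_lt_left hm).2 hp.one_lt
    obtain ⟨w, h, hw, hg, hh⟩ := ih m hlt hm (by omega)
    refine ⟨w, h, hw, ?_, ?_⟩
    · rw [mul_comm p m, pow_mul, gaussSum_pow_char, mul_comm m p, digitSum_base_mul hp.one_lt, hg]
    · rw [digitFacProd_base_mul hp.one_lt, hh]
  obtain ⟨m, rfl⟩ : ∃ m, k = m + 1 := ⟨k - 1, by omega⟩
  rcases m.eq_zero_or_pos with rfl | hm
  · refine ⟨1, h₁, by simp, ?_, ?_⟩
    · simp only [zero_add, pow_one, one_mul, digitSum_one hp.one_lt, hg₁]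
    · simp [digitFacProd_one hp.one_lt, hh₁]
  obtain ⟨w, h, hw, hg, hh⟩ := ih m (by omega) hm (by omega)
  have hJ := map_jacobiSum_pow red hχ hm hk'
  have hne : ((m : F) + 1) ≠ 0 := by
    intro h0
    apply hdvd
    rw [← CharP.cast_eq_zero_iff F p]
    exact_mod_cast h0
  have hmul := jacobiSum_mul_nontrivial (χ := χ) (φ := χ ^ m)
    (by rw [← pow_succ']; exact pow_ne_one_of_map_eq_inv red hχ hk hk') (traceAddChar F hζ)
  rw [← pow_succ'] at hmul
  refine ⟨w * jacobiSum χ (χ ^ m), h₁ * h, ?_, ?_, ?_⟩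
  · rw [map_mul, hJ]
    exact mul_ne_zero hw (neg_ne_zero.2 hne)
  · rw [digitSum_succ_of_not_dvd hp.one_lt hdvd, pow_succ (ζ - 1)]
    linear_combination w * hmul + gaussSum χ (traceAddChar F hζ) * hg +
      (ζ - 1) ^ digitSum p m * h * hg₁
  · rw [digitFacProd_succ_of_not_dvd hp.one_lt hdvd, map_mul, map_mul, hh₁, hJ, Nat.cast_mul]
    have : (((m + 1) % p : ℕ) : F) = m + 1 := by
      rw [← CharP.cast_eq_mod F p, Nat.cast_succ]
    rw [this]
    linear_combination -((m : F) + 1) * hh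

end Stickelberger

section Congruence

variable {F R : Type*} [Field F] [Fintype F] [CommRing R] [IsDomain R] {p : ℕ} [Fact p.Prime]
  [Algebra (ZMod p) F] (red : R →+* F)

omit [Algebra (ZMod p) F] [Fact p.Prime] in
/-- A section of the reduction map by `(q - 1)`-st roots of unity is a multiplicative character. -/
theorem exists_mulChar_coe_eq {ω : F → R} (hω0 : ω 0 = 0)
    (hωroot : ∀ r, r ≠ 0 → ω r ^ (Fintype.card F - 1) = 1) (hωlift : ∀ r, red (ω r) = r) :
    ∃ T : MulChar F R, ⇑T = ω := by
  classical
  have hq : 0 < Fintype.card F - 1 := Nat.sub_pos_of_lt Fintype.one_lt_card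
  have hinj : Function.Injective ω := Function.LeftInverse.injective hωlift
  have himage : (Finset.univ.erase 0).image ω =
      Polynomial.nthRootsFinset (Fintype.card F - 1) (1 : R) := by
    refine Finset.eq_of_subset_of_card_le ?_ ?_
    · intro x hx
      obtain ⟨r, hr, rfl⟩ := Finset.mem_image.1 hx
      exact (Polynomial.mem_nthRootsFinset hq 1).2 (hωroot r (Finset.ne_of_mem_erase hr))
    · rw [Finset.card_image_of_injective _ hinj, Finset.card_erase_of_mem (Finset.mem_univ _),
        Finset.card_univ]
      exact (Multiset.toFinset_card_le _).trans (Polynomial.card_nthRoots _ _)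
  have huniq : ∀ x : R, x ^ (Fintype.card F - 1) = 1 → ω (red x) = x := by
    intro x hx
    have := (Polynomial.mem_nthRootsFinset hq 1).2 hx
    rw [← himage] at this
    obtain ⟨r, -, rfl⟩ := Finset.mem_image.1 this
    rw [hωlift]
  refine ⟨{ toFun := ω, map_one' := ?_, map_mul' := ?_, map_nonunit' := ?_ }, rfl⟩
  · simpa using huniq 1 (one_pow _)
  · intro a b
    by_cases ha : a = 0
    · simp [ha, hω0]
    by_cases hb : b = 0
    · simp [hb, hω0]
    have := huniq (ω a * ω b) (by rw [mul_pow, hωroot a ha, hωroot b hb, one_mul])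
    rwa [map_mul, hωlift, hωlift] at this
  · intro a ha
    rw [show a = 0 by simpa using ha, hω0]

variable {T : MulChar F R}

theorem map_gaussSum_pow_eq {ζ : R} (hζ : IsPrimitiveRoot ζ p) {n N s : ℕ} (hn0 : 0 < n)
    (hs0 : 0 < s) (hnN : n * N = Fintype.card F - 1) (hNp : (p - 1).Coprime N)
    (φ : R ≃+* R) (hφ : ∀ u, φ (T u) = T u ^ s) :
    φ (gaussSum (T ^ n) (traceAddChar F hζ.pow_eq_one)) =
      gaussSum (T ^ (s * n)) (traceAddChar F hζ.pow_eq_one) := by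
  have : CharP F p := charP_of_injective_algebraMap' (ZMod p) p
  have hp : p.Prime := Fact.out
  have : NeZero p := ⟨hp.ne_zero⟩
  have hφζ : IsPrimitiveRoot (φ ζ) p := hζ.map_of_injective φ.injective
  obtain ⟨c, -, hc⟩ := hζ.eq_pow_of_pow_eq_one hφζ.pow_eq_one
  rw [← hc, hζ.pow_iff_coprime hp.pos] at hφζ
  have hc0 : (c : F) ≠ 0 := by
    rw [Ne, CharP.cast_eq_zero_iff F p]
    exact fun h => hp.one_lt.ne' (Nat.eq_one_of_dvd_coprimes hφζ h dvd_rfl)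
  have hcp : (c : F) ^ (p - 1) = 1 := by
    have h := ZMod.pow_card_sub_one_eq_one (p := p) (a := (c : ZMod p)) (by
      intro h
      apply hc0
      simpa using congrArg (algebraMap (ZMod p) F) h)
    simpa using congrArg (algebraMap (ZMod p) F) h
  have hTc : T c ^ n = 1 := by
    have h1 : (T c ^ n) ^ (p - 1) = 1 := by
      rw [← pow_mul, mul_comm, pow_mul, ← map_pow, hcp, map_one, one_pow]
    have h2 : (T c ^ n) ^ N = 1 := by
      rw [← pow_mul, hnN, ← map_pow, FiniteField.pow_card_sub_one_eq_one _ hc0, map_one]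
    simpa [hNp.gcd_eq_one] using pow_gcd_eq_one.2 ⟨h1, h2⟩
  have hshift := gaussSum_mulShift (T ^ (s * n)) (traceAddChar F hζ.pow_eq_one)
    (Units.mk0 (c : F) hc0)
  rw [MulChar.pow_apply_coe, Units.val_mk0, mul_comm s n, pow_mul, hTc, one_pow, one_mul,
    mul_comm n s] at hshift
  rw [← hshift, gaussSum, gaussSum, map_sum]
  refine Finset.sum_congr rfl fun z _ => ?_
  rw [map_mul, T.pow_apply' hn0.ne', map_pow, hφ, T.pow_apply' (Nat.mul_pos hs0 hn0).ne', ← pow_mul,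
    AddChar.mulShift_apply, ← nsmul_eq_mul, AddChar.map_nsmul_eq_pow, traceAddChar_apply, map_pow,
    ← hc, ← pow_mul, ← pow_mul, mul_comm c]

theorem congruence_of_gaussSum_eq (hodd : Odd p) (hT : ∀ u, red (T u) = u) {ζ : R}
    (hζ : IsPrimitiveRoot ζ p) {n N s : ℕ} (hN : 2 ≤ N)
    (hsN : s.Coprime N) (hnN : n * N = Fintype.card F - 1) (hNp : (p - 1).Coprime N)
    (φ : R ≃+* R) (hφ : ∀ u, φ (T u) = T u ^ s) {A : R} {x y : ℕ}
    (hG : 2 ^ y * gaussSum (T ^ n) (traceAddChar F hζ.pow_eq_one) = (p : R) ^ x * A) :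
    (digitSum p (Fintype.card F - 1 - s * n % (Fintype.card F - 1)) = (p - 1) * x →
      red (digitFacProd p (Fintype.card F - 1 - s * n % (Fintype.card F - 1)) * φ A -
        (-1) ^ (x + 1) * 2 ^ y) = 0) ∧
    ((p - 1) * x < digitSum p (Fintype.card F - 1 - s * n % (Fintype.card F - 1)) →
      red (φ A) = 0) := by
  have : CharP F p := charP_of_injective_algebraMap' (ZMod p) p
  have hp : p.Prime := Fact.out
  have hq1 : 0 < Fintype.card F - 1 := Nat.sub_pos_of_lt Fintype.one_lt_card
  have hn0 : 0 < n := Nat.pos_of_ne_zero (by rintro rfl; omega)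
  have hs0 : 0 < s := Nat.pos_of_ne_zero (by rintro rfl; simp at hsN; omega)
  have hq : 2 < Fintype.card F := by
    have := Nat.mul_le_mul hn0 hN
    omega
  have hm : 0 < s * n % (Fintype.card F - 1) := by
    refine Nat.pos_of_ne_zero fun h => ?_
    rw [← hnN, mul_comm s] at h
    have h1 : N ∣ s := Nat.dvd_of_mul_dvd_mul_left hn0 (Nat.dvd_of_mod_eq_zero h)
    have := Nat.eq_one_of_dvd_coprimes hsN h1 dvd_rfl
    omega
  have hm' := Nat.mod_lt (s * n) hq1
  set m := s * n % (Fintype.card F - 1) with hmdef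
  have hχ : ∀ u, red (T⁻¹ u) = u⁻¹ := fun u => by rw [MulChar.inv_apply', hT]
  have hTq : T ^ (Fintype.card F - 1) = 1 := by
    classical
    rw [← Fintype.card_units]
    exact T.pow_card_eq_one
  have hTm : T ^ (s * n) = T⁻¹ ^ (Fintype.card F - 1 - m) := by
    rw [inv_pow, eq_inv_iff_mul_eq_one, pow_eq_pow_mod _ hTq, ← hmdef, ← pow_add,
      Nat.add_sub_cancel' hm'.le, hTq]
  obtain ⟨w, h, hw, hg, hh⟩ := exists_mul_gaussSum_pow_eq red hχ hq hζ.pow_eq_one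
    (k := Fintype.card F - 1 - m) (by omega) (by omega)
  obtain ⟨u, hpu, hu⟩ := exists_eq_pow_sub_one_mul red hζ hodd
  have hGφ := congrArg φ hG
  simp only [map_mul, map_pow, map_ofNat, map_natCast] at hGφ
  rw [map_gaussSum_pow_eq hζ hn0 hs0 hnN hNp φ hφ, hTm] at hGφ
  have hπ : ζ - 1 ≠ 0 := sub_ne_zero.2 (hζ.ne_one hp.one_lt)
  have hkey : (ζ - 1) ^ ((p - 1) * x) * (w * u ^ x * φ A) =
      2 ^ y * ((ζ - 1) ^ digitSum p (Fintype.card F - 1 - m) * h) := by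
    rw [← hg]
    rw [hpu, mul_pow, ← pow_mul] at hGφ
    linear_combination -w * hGφ
  have hmap : ∀ z : R, red (w * u ^ x * z) = red w * ((-1) ^ x * red z) := by
    intro z
    rw [map_mul, map_mul, map_pow, hu, mul_assoc]
  refine ⟨fun hS => ?_, fun hS => ?_⟩
  · rw [hS, mul_left_comm (2 ^ y : R)] at hkey
    have h1 := congrArg red (mul_left_cancel₀ (pow_ne_zero _ hπ) hkey)
    rw [hmap, map_mul, map_pow, map_ofNat] at h1
    have h2 : red w * ((-1) ^ x * ((digitFacProd p (Fintype.card F - 1 - m) : F) * red (φ A) -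
        (-1) ^ (x + 1) * 2 ^ y)) = 0 := by
      have hsq : ((-1 : F) ^ x) * (-1) ^ x = 1 := by rw [← mul_pow]; simp
      linear_combination (digitFacProd p (Fintype.card F - 1 - m) : F) * h1 + 2 ^ y * hh +
        2 ^ y * red w * hsq
    simpa only [map_sub, map_mul, map_pow, map_neg, map_one, map_natCast, map_ofNat] using
      (mul_eq_zero.1 ((mul_eq_zero.1 h2).resolve_left hw)).resolve_left (by simp)
  · obtain ⟨d, hd⟩ := Nat.exists_eq_add_of_lt hS
    rw [hd, add_assoc, pow_add, mul_assoc ((ζ - 1) ^ _),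
      mul_left_comm (2 ^ y : R)] at hkey
    have h1 := congrArg red (mul_left_cancel₀ (pow_ne_zero _ hπ) hkey)
    rw [hmap, map_mul, map_mul, map_pow _ (ζ - 1),
      map_sub_one_eq_zero_of_pow_char red hζ.pow_eq_one, zero_pow d.succ_ne_zero] at h1
    simpa [hw] using h1

end Congruence

/-- **Sign determination in the non-cyclic index 4 case:
`G(χ) = 2^{−y} p^x (a + b√−L)(a′ + b′√−L′)`.**
Let `p` be an odd prime and `N` odd with `gcd(p(p−1), N) = 1`, let the order `f` of `p`
mod `N` equal `φ(N)/4`, let `(ℤ/Nℤ)^*/⟨p⟩` be non-cyclic of order `4` (generated by the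
classes of `s` and `t`, with `s², t², (st)² ∈ ⟨p⟩` but `s, t, st ∉ ⟨p⟩`), and
`−1 ∉ ⟨p⟩`, so the decomposition field `K` of `p` in `ℚ(ζ_N)` is an imaginary abelian
quartic field containing `√−L` and `√−L′` (`L ≠ L′` squarefree positive); the Galois
automorphisms `σ, τ` (with `σζ_N = ζ_N^s`, `τζ_N = ζ_N^t`) satisfy `σ(√−L) = −√−L`,
`σ(√−L′) = √−L′`, `τ(√−L) = √−L`, `τ(√−L′) = −√−L′`.  Let `q = p^f`, `n = (q−1)/N`,
`E = ℚ(ζ_{q−1}, ζ_p)`, `𝔓` the prime of `𝓞 E` above `p` with residue field `F_q`, `ω`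
the Teichmüller map, `χ = ω^n`, and `G(χ) = ∑_{z ≠ 0} ω(z)^n ζp^{T(z)}` the Gauss sum.
If `2^y·G(χ) = p^x·(a + b√−L)·(a′ + b′√−L′)` then the four congruences (i)–(iv) below
hold modulo `𝔓`, where `S(−n), S(−sn), S(−tn), S(−stn)` are the digit sums of the
residues of `−n, −sn, −tn, −stn` modulo `q−1`, and `t(·)` the corresponding factorial
products. -/
theorem sign_determination_index_four_noncyclic
    (p N f q n : ℕ) (hp : p.Prime) (hodd : Odd p) (hNodd : Odd N)
    (hN : 2 ≤ N) (hNp : Nat.Coprime (p * (p - 1)) N)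
    (hf : orderOf (p : ZMod N) = f) (hq : q = p ^ f) (hn : n = (q - 1) / N)
    (hindex : 4 * f = Nat.totient N)
    (hneg : ∀ k : ℕ, (p : ZMod N) ^ k ≠ -1)
    -- generators `s, t` of the non-cyclic quotient `(ℤ/Nℤ)^*/⟨p⟩ ≅ ℤ/2 × ℤ/2`
    (s t : ℕ) (hsN : s.Coprime N) (htN : t.Coprime N)
    (hs2 : ∃ k : ℕ, ((s : ZMod N)) ^ 2 = (p : ZMod N) ^ k)
    (ht2 : ∃ k : ℕ, ((t : ZMod N)) ^ 2 = (p : ZMod N) ^ k)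
    (hsnot : ∀ k : ℕ, (s : ZMod N) ≠ (p : ZMod N) ^ k)
    (htnot : ∀ k : ℕ, (t : ZMod N) ≠ (p : ZMod N) ^ k)
    (hstnot : ∀ k : ℕ, (s : ZMod N) * (t : ZMod N) ≠ (p : ZMod N) ^ k)
    (E : Type) [Field E] [NumberField E]
    (ζ ζp : 𝓞 E)
    (hζ : IsPrimitiveRoot ζ (q - 1)) (hζp : IsPrimitiveRoot ζp p)
    (hgen : Algebra.adjoin ℚ {(ζ : E), (ζp : E)} = ⊤)
    (𝔓 : Ideal (𝓞 E)) (hprime : 𝔓.IsPrime) (hp𝔓 : (p : 𝓞 E) ∈ 𝔓)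
    [Fintype (𝓞 E ⧸ 𝔓)] [DecidableEq (𝓞 E ⧸ 𝔓)]
    (hcard : Fintype.card (𝓞 E ⧸ 𝔓) = q)
    [Algebra (ZMod p) (𝓞 E ⧸ 𝔓)]
    (ω : (𝓞 E ⧸ 𝔓) → 𝓞 E)
    (hω0 : ω 0 = 0)
    (hωroot : ∀ r : 𝓞 E ⧸ 𝔓, r ≠ 0 → ω r ^ (q - 1) = 1)
    (hωlift : ∀ r : 𝓞 E ⧸ 𝔓, Ideal.Quotient.mk 𝔓 (ω r) = r)
    -- the square roots `√−L, √−L′` in the decomposition field `K ⊆ ℚ(ζ_N)`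
    (L L' : ℕ) (hL : 0 < L) (hL' : 0 < L') (hLL' : L ≠ L')
    (hLsf : Squarefree L) (hL'sf : Squarefree L')
    (sL sL' : 𝓞 E) (hsL : sL ^ 2 = -(L : 𝓞 E)) (hsL' : sL' ^ 2 = -(L' : 𝓞 E))
    (hsLmem : (sL : E) ∈ Algebra.adjoin ℚ {((ζ : E)) ^ n})
    (hsL'mem : (sL' : E) ∈ Algebra.adjoin ℚ {((ζ : E)) ^ n})
    -- the Galois automorphisms `σ, τ` and their action on `√−L, √−L′`
    (σ τ : E ≃ₐ[ℚ] E)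
    (hσζ : σ (ζ : E) = (ζ : E) ^ s) (hτζ : τ (ζ : E) = (ζ : E) ^ t)
    (hσL : σ (sL : E) = -(sL : E)) (hσL' : σ (sL' : E) = (sL' : E))
    (hτL : τ (sL : E) = (sL : E)) (hτL' : τ (sL' : E) = -(sL' : E))
    (a b a' b' : ℤ) (x y : ℕ)
    (hG : (2 : 𝓞 E) ^ y *
        (∑ z ∈ Finset.univ.filter (fun z : 𝓞 E ⧸ 𝔓 => z ≠ 0),
          ω z ^ n * ζp ^ (Algebra.trace (ZMod p) (𝓞 E ⧸ 𝔓) z).val)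
      = (p : 𝓞 E) ^ x * ((a : 𝓞 E) + (b : 𝓞 E) * sL) *
          ((a' : 𝓞 E) + (b' : 𝓞 E) * sL')) :
    -- (i)
    ((digitSum p (q - 1 - n) = (p - 1) * x →
        (digitFacProd p (q - 1 - n) : 𝓞 E) *
            (((a : 𝓞 E) + (b : 𝓞 E) * sL) * ((a' : 𝓞 E) + (b' : 𝓞 E) * sL')) -
          (-1) ^ (x + 1) * 2 ^ y ∈ 𝔓) ∧
      ((p - 1) * x < digitSum p (q - 1 - n) →
        ((a : 𝓞 E) + (b : 𝓞 E) * sL) * ((a' : 𝓞 E) + (b' : 𝓞 E) * sL') ∈ 𝔓)) ∧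
    -- (ii)
    ((digitSum p (q - 1 - s * n % (q - 1)) = (p - 1) * x →
        (digitFacProd p (q - 1 - s * n % (q - 1)) : 𝓞 E) *
            (((a : 𝓞 E) - (b : 𝓞 E) * sL) * ((a' : 𝓞 E) + (b' : 𝓞 E) * sL')) -
          (-1) ^ (x + 1) * 2 ^ y ∈ 𝔓) ∧
      ((p - 1) * x < digitSum p (q - 1 - s * n % (q - 1)) →
        ((a : 𝓞 E) - (b : 𝓞 E) * sL) * ((a' : 𝓞 E) + (b' : 𝓞 E) * sL') ∈ 𝔓)) ∧
    -- (iii)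
    ((digitSum p (q - 1 - t * n % (q - 1)) = (p - 1) * x →
        (digitFacProd p (q - 1 - t * n % (q - 1)) : 𝓞 E) *
            (((a : 𝓞 E) + (b : 𝓞 E) * sL) * ((a' : 𝓞 E) - (b' : 𝓞 E) * sL')) -
          (-1) ^ (x + 1) * 2 ^ y ∈ 𝔓) ∧
      ((p - 1) * x < digitSum p (q - 1 - t * n % (q - 1)) →
        ((a : 𝓞 E) + (b : 𝓞 E) * sL) * ((a' : 𝓞 E) - (b' : 𝓞 E) * sL') ∈ 𝔓)) ∧
    -- (iv)
    ((digitSum p (q - 1 - s * t * n % (q - 1)) = (p - 1) * x →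
        (digitFacProd p (q - 1 - s * t * n % (q - 1)) : 𝓞 E) *
            (((a : 𝓞 E) - (b : 𝓞 E) * sL) * ((a' : 𝓞 E) - (b' : 𝓞 E) * sL')) -
          (-1) ^ (x + 1) * 2 ^ y ∈ 𝔓) ∧
      ((p - 1) * x < digitSum p (q - 1 - s * t * n % (q - 1)) →
        ((a : 𝓞 E) - (b : 𝓞 E) * sL) * ((a' : 𝓞 E) - (b' : 𝓞 E) * sL') ∈ 𝔓)) := by
  have hfact : Fact p.Prime := ⟨hp⟩
  have hmax : 𝔓.IsMaximal :=
    Ideal.Quotient.maximal_of_isField 𝔓 (Finite.isField_of_domain (𝓞 E ⧸ 𝔓))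
  let _ : Field (𝓞 E ⧸ 𝔓) := Ideal.Quotient.field 𝔓
  have hqpos : 1 < q := hcard ▸ Fintype.one_lt_card
  have hpow : (p : ZMod N) ^ f = 1 := hf ▸ pow_orderOf_eq_one _
  have hnN : n * N = q - 1 := by
    rw [hn]
    refine Nat.div_mul_cancel ?_
    rw [← CharP.cast_eq_zero_iff (ZMod N) N, Nat.cast_sub hqpos.le, hq]
    simp [hpow]
  have hn0 : n ≠ 0 := by
    rintro rfl
    omega
  obtain ⟨T, rfl⟩ := exists_mulChar_coe_eq (Ideal.Quotient.mk 𝔓) hω0 (hcard ▸ hωroot) hωlift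
  have hTζ : ∀ (φ : 𝓞 E ≃+* 𝓞 E) (m : ℕ), φ ζ = ζ ^ m → m ≠ 0 → ∀ u, φ (T u) = T u ^ m := by
    intro φ m hφ hm u
    by_cases hu : u = 0
    · rw [hu, hω0, map_zero, zero_pow hm]
    have : NeZero (q - 1) := ⟨by omega⟩
    obtain ⟨i, -, hi⟩ := hζ.eq_pow_of_pow_eq_one (hωroot u hu)
    rw [← hi, map_pow, hφ, ← pow_mul, ← pow_mul, mul_comm]
  have hG' : 2 ^ y * gaussSum (T ^ n) (traceAddChar (𝓞 E ⧸ 𝔓) hζp.pow_eq_one) =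
      (p : 𝓞 E) ^ x * (((a : 𝓞 E) + (b : 𝓞 E) * sL) * ((a' : 𝓞 E) + (b' : 𝓞 E) * sL')) := by
    rw [← mul_assoc, ← hG, gaussSum, Finset.sum_filter]
    congr 1
    refine Finset.sum_congr rfl fun z _ => ?_
    split_ifs with hz
    · rw [T.pow_apply' hn0, traceAddChar_apply]
    · rw [not_not.1 hz, MulChar.map_zero, zero_mul]
  have hcop0 : ∀ m : ℕ, m.Coprime N → m ≠ 0 := by
    rintro m hm rfl
    simp at hm
    omega
  have key : ∀ (φ : 𝓞 E ≃+* 𝓞 E) (m : ℕ) (A : 𝓞 E), φ ζ = ζ ^ m → m.Coprime N →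
      φ (((a : 𝓞 E) + (b : 𝓞 E) * sL) * ((a' : 𝓞 E) + (b' : 𝓞 E) * sL')) = A →
      (digitSum p (q - 1 - m * n % (q - 1)) = (p - 1) * x →
        (digitFacProd p (q - 1 - m * n % (q - 1)) : 𝓞 E) * A -
          (-1) ^ (x + 1) * 2 ^ y ∈ 𝔓) ∧
      ((p - 1) * x < digitSum p (q - 1 - m * n % (q - 1)) → A ∈ 𝔓) := by
    rintro φ m A hφ hm rfl
    have h := congruence_of_gaussSum_eq (Ideal.Quotient.mk 𝔓) hodd hωlift hζp hN hm
      (hcard ▸ hnN) hNp.coprime_mul_left φ (hTζ φ m hφ (hcop0 m hm)) hG'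
    rwa [hcard, Ideal.Quotient.eq_zero_iff_mem, Ideal.Quotient.eq_zero_iff_mem] at h
  let σ' : 𝓞 E ≃+* 𝓞 E := RingOfIntegers.mapRingEquiv σ
  let τ' : 𝓞 E ≃+* 𝓞 E := RingOfIntegers.mapRingEquiv τ
  have hσ'ζ : σ' ζ = ζ ^ s := RingOfIntegers.ext (by simpa [σ'] using hσζ)
  have hτ'ζ : τ' ζ = ζ ^ t := RingOfIntegers.ext (by simpa [τ'] using hτζ)
  have hσ'L : σ' sL = -sL := RingOfIntegers.ext (by simpa [σ'] using hσL)
  have hσ'L' : σ' sL' = sL' := RingOfIntegers.ext (by simpa [σ'] using hσL')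
  have hτ'L : τ' sL = sL := RingOfIntegers.ext (by simpa [τ'] using hτL)
  have hτ'L' : τ' sL' = -sL' := RingOfIntegers.ext (by simpa [τ'] using hτL')
  have hnlt : n % (q - 1) = n := Nat.mod_eq_of_lt (by
    rw [← hnN]
    exact lt_mul_of_one_lt_right (Nat.pos_of_ne_zero hn0) hN)
  refine ⟨?_, ?_, ?_, ?_⟩
  · have h := key (RingEquiv.refl _) 1 _ (by simp) (Nat.coprime_one_left N) rfl
    rwa [one_mul, hnlt] at h
  · refine key σ' s _ hσ'ζ hsN ?_
    simp only [map_mul, map_add, map_intCast, hσ'L, hσ'L']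
    ring
  · refine key τ' t _ hτ'ζ htN ?_
    simp only [map_mul, map_add, map_intCast, hτ'L, hτ'L']
    ring
  · refine key (τ'.trans σ') (s * t) _ ?_ (hsN.mul_left htN) ?_
    · rw [RingEquiv.trans_apply, hτ'ζ, map_pow, hσ'ζ, ← pow_mul]
    · simp only [RingEquiv.trans_apply, map_mul, map_add, map_neg, map_intCast, hσ'L, hσ'L',
        hτ'L, hτ'L']
      ring
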